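/- arXiv:1909.09345 — 2 statements merged into one kernel-verified Lean document; each statement's English description precedes it below -/
import Mathlib

section
/- Let p ≥ 1, let λ = (λ₁,…,λ_p) be nonincreasing nonnegative weights with λ₁ > 0, let x ∈ ℝ^p, and fix χ > 0. Define f(v) = E‖η(x + √v·h; √v·χ, λ) − x‖₂² for v > 0. Then the map v ↦ f(v)/v is nonincreasing on (0, ∞), and it is strictly decreasing if x ≠ 0. -/
open MeasureTheory ProbabilityTheory Filter

/-- Standard Gaussian measure `N(0, I_n)` on `ℝⁿ`. -/
noncomputable def stdGaussian (n : ℕ) : Measure (Fin n → ℝ) :=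
  Measure.pi fun _ => gaussianReal 0 1

/-- The nonincreasing rearrangement of the absolute values of the entries of `x`. -/
noncomputable def sortedAbs {n : ℕ} (x : Fin n → ℝ) : Fin n → ℝ :=
  fun i => |x ((Tuple.sort fun j => -|x j|) i)|

/-- The sorted-ℓ1 (SLOPE) norm `‖x‖_λ = ∑ λ_i |x|_(i)`. -/
noncomputable def slopeNorm {n : ℕ} (lam x : Fin n → ℝ) : ℝ :=
  ∑ i, lam i * sortedAbs x i

/-- The SLOPE proximal objective `½‖u − v‖₂² + γ‖v‖_λ`. -/
noncomputable def slopeObj {n : ℕ} (lam : Fin n → ℝ) (γ : ℝ) (u v : Fin n → ℝ) : ℝ :=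
  (1/2) * ∑ i, (u i - v i)^2 + γ * slopeNorm lam v

/-- `v` is a minimizer of the SLOPE proximal objective, i.e. `v = η(u; γ, λ)`
(the minimizer is unique since the objective is strictly convex). -/
def IsSlopeProx {n : ℕ} (lam : Fin n → ℝ) (γ : ℝ) (u v : Fin n → ℝ) : Prop :=
  ∀ w, slopeObj lam γ u v ≤ slopeObj lam γ u w

theorem slopeNorm_eq_sum_sort {n : ℕ} (lam x : Fin n → ℝ) :
    slopeNorm lam x = ∑ i, lam i * |x ((Tuple.sort fun j => -|x j|) i)| := rfl

/-- The rearrangement inequality for the sorted-ℓ1 norm. -/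
theorem sum_mul_abs_comp_perm_le_slopeNorm {n : ℕ} {lam : Fin n → ℝ} (hlam : Antitone lam)
    (x : Fin n → ℝ) (τ : Equiv.Perm (Fin n)) :
    ∑ i, lam i * |x (τ i)| ≤ slopeNorm lam x := by
  set σ := Tuple.sort fun j => -|x j| with hσ
  have hsort : Antitone fun i => |x (σ i)| := fun i j hij => by
    have := Tuple.monotone_sort (fun j => -|x j|) hij
    simpa [Function.comp, hσ] using this
  have := (hlam.monovary hsort).sum_mul_comp_perm_le_sum_mul (σ := τ.trans σ.symm)
  simpa [slopeNorm_eq_sum_sort, ← hσ] using this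

theorem slopeNorm_add_le {n : ℕ} {lam : Fin n → ℝ} (hlam : Antitone lam) (hnonneg : ∀ i, 0 ≤ lam i)
    (x y : Fin n → ℝ) : slopeNorm lam (x + y) ≤ slopeNorm lam x + slopeNorm lam y := by
  refine le_trans ?_ (add_le_add
    (sum_mul_abs_comp_perm_le_slopeNorm hlam x (Tuple.sort fun j => -|(x + y) j|))
    (sum_mul_abs_comp_perm_le_slopeNorm hlam y (Tuple.sort fun j => -|(x + y) j|)))
  rw [slopeNorm_eq_sum_sort, ← Finset.sum_add_distrib]
  refine Finset.sum_le_sum fun i _ => ?_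
  rw [← mul_add]
  exact mul_le_mul_of_nonneg_left (abs_add_le _ _) (hnonneg i)

theorem slopeNorm_smul_le {n : ℕ} {lam : Fin n → ℝ} (hlam : Antitone lam)
    {c : ℝ} (hc : 0 ≤ c) (x : Fin n → ℝ) : slopeNorm lam (c • x) ≤ c * slopeNorm lam x := by
  refine le_trans (le_of_eq ?_) (mul_le_mul_of_nonneg_left
    (sum_mul_abs_comp_perm_le_slopeNorm hlam x (Tuple.sort fun j => -|(c • x) j|)) hc)
  rw [slopeNorm_eq_sum_sort, Finset.mul_sum]
  refine Finset.sum_congr rfl fun i _ => ?_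
  simp only [Pi.smul_apply, smul_eq_mul, abs_mul, abs_of_nonneg hc]
  ring

theorem slopeNorm_nonneg {n : ℕ} {lam : Fin n → ℝ} (hnonneg : ∀ i, 0 ≤ lam i) (x : Fin n → ℝ) :
    0 ≤ slopeNorm lam x :=
  Finset.sum_nonneg fun i _ => mul_nonneg (hnonneg i) (abs_nonneg _)

theorem slopeNorm_pos {n : ℕ} (hn : 1 ≤ n) {lam : Fin n → ℝ} (hlam : Antitone lam)
    (hnonneg : ∀ i, 0 ≤ lam i) (hpos : 0 < lam ⟨0, hn⟩) {x : Fin n → ℝ} (hx : x ≠ 0) :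
    0 < slopeNorm lam x := by
  obtain ⟨j, hj⟩ := Function.ne_iff.mp hx
  refine lt_of_lt_of_le ?_
    (sum_mul_abs_comp_perm_le_slopeNorm hlam x (Equiv.swap ⟨0, hn⟩ j))
  refine Finset.sum_pos' (fun i _ => mul_nonneg (hnonneg i) (abs_nonneg _))
    ⟨⟨0, hn⟩, Finset.mem_univ _, ?_⟩
  rw [Equiv.swap_apply_left]
  exact mul_pos hpos (abs_pos.mpr hj)

/-- First-order optimality conditions for `v = η(u; γ, λ)`: the residual `u − v` belongs to the
polar of `γ‖·‖_λ` and supports it at `v`. -/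
structure SlopeOptimal {n : ℕ} (lam : Fin n → ℝ) (γ : ℝ) (u v : Fin n → ℝ) : Prop where
  residual_le : ∀ w, ∑ i, (u i - v i) * w i ≤ γ * slopeNorm lam w
  le_residual : γ * slopeNorm lam v ≤ ∑ i, (u i - v i) * v i

theorem le_of_forall_mem_Ioc_mul_le {a b c : ℝ}
    (h : ∀ ε, 0 < ε → ε ≤ 1 → ε * a ≤ ε * b + ε ^ 2 * c) : a ≤ b := by
  refine ge_of_tendsto (f := fun ε : ℝ => b + ε * c) (x := nhdsWithin 0 (Set.Ioi 0)) ?_ ?_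
  · have : Tendsto (fun ε : ℝ => b + ε * c) (nhds 0) (nhds (b + 0 * c)) :=
      Continuous.tendsto (by fun_prop) 0
    rw [zero_mul, add_zero] at this
    exact this.mono_left nhdsWithin_le_nhds
  · filter_upwards [Ioc_mem_nhdsGT (zero_lt_one (α := ℝ))] with ε hε
    refine le_of_mul_le_mul_left ?_ hε.1
    linarith [h ε hε.1 hε.2]

theorem IsSlopeProx.slopeOptimal {n : ℕ} {lam : Fin n → ℝ} (hlam : Antitone lam)
    (hnonneg : ∀ i, 0 ≤ lam i) {γ : ℝ} (hγ : 0 ≤ γ) {u v : Fin n → ℝ}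
    (h : IsSlopeProx lam γ u v) : SlopeOptimal lam γ u v := by
  have quad (c : ℝ) (w : Fin n → ℝ) : ∑ i, (u i - (v + c • w) i) ^ 2 =
      ∑ i, (u i - v i) ^ 2 - 2 * c * ∑ i, (u i - v i) * w i + c ^ 2 * ∑ i, w i ^ 2 := by
    simp only [Finset.mul_sum, ← Finset.sum_add_distrib, ← Finset.sum_sub_distrib]
    refine Finset.sum_congr rfl fun i _ => ?_
    simp only [Pi.add_apply, Pi.smul_apply, smul_eq_mul]
    ring
  constructor
  · intro w
    refine le_of_forall_mem_Ioc_mul_le (c := (1 / 2) * ∑ i, w i ^ 2) fun ε hε _ => ?_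
    have hmin := h (v + ε • w)
    have hnorm := mul_le_mul_of_nonneg_left ((slopeNorm_add_le hlam hnonneg v (ε • w)).trans
      (add_le_add_right (slopeNorm_smul_le hlam hε.le w) _)) hγ
    rw [slopeObj, slopeObj, quad] at hmin
    linarith
  · refine le_of_forall_mem_Ioc_mul_le (c := (1 / 2) * ∑ i, v i ^ 2) fun ε hε hε1 => ?_
    have hmin := h (v + (-ε) • v)
    have hnorm := mul_le_mul_of_nonneg_left
      (slopeNorm_smul_le hlam (sub_nonneg.mpr hε1) v) hγ
    rw [slopeObj, slopeObj, quad, show v + (-ε) • v = (1 - ε) • v by module] at hmin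
    linarith

theorem SlopeOptimal.smul {n : ℕ} {lam : Fin n → ℝ} (hlam : Antitone lam) {γ c : ℝ}
    (hγ : 0 ≤ γ) (hc : 0 ≤ c) {u v : Fin n → ℝ} (h : SlopeOptimal lam γ u v) :
    SlopeOptimal lam (c * γ) (c • u) (c • v) := by
  have scale (w : Fin n → ℝ) : ∑ i, ((c • u) i - (c • v) i) * w i =
      c * ∑ i, (u i - v i) * w i := by
    rw [Finset.mul_sum]
    refine Finset.sum_congr rfl fun i _ => ?_
    simp only [Pi.smul_apply, smul_eq_mul]
    ring
  constructor
  · intro w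
    rw [scale, mul_assoc]
    exact mul_le_mul_of_nonneg_left (h.residual_le w) hc
  · have hsum : ∑ i, (u i - v i) * (c • v) i = c * ∑ i, (u i - v i) * v i := by
      rw [Finset.mul_sum]
      refine Finset.sum_congr rfl fun i _ => ?_
      simp only [Pi.smul_apply, smul_eq_mul]
      ring
    rw [scale, hsum, mul_assoc]
    refine mul_le_mul_of_nonneg_left ?_ hc
    calc γ * slopeNorm lam (c • v) ≤ γ * (c * slopeNorm lam v) :=
          mul_le_mul_of_nonneg_left (slopeNorm_smul_le hlam hc v) hγ
      _ = c * (γ * slopeNorm lam v) := by ring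
      _ ≤ _ := mul_le_mul_of_nonneg_left h.le_residual hc

/-- The variational inequality for the residuals of two proximal problems. -/
theorem SlopeOptimal.sum_residual_sub_mul_nonneg {n : ℕ} {lam : Fin n → ℝ} {γ : ℝ}
    {u v u' v' : Fin n → ℝ} (h : SlopeOptimal lam γ u v) (h' : SlopeOptimal lam γ u' v') :
    0 ≤ ∑ i, ((u i - v i) - (u' i - v' i)) * v i := by
  simp only [sub_mul (_ - _), Finset.sum_sub_distrib]
  exact sub_nonneg.mpr ((h'.residual_le v).trans h.le_residual)

theorem SlopeOptimal.sum_sq_sub_le {n : ℕ} {lam : Fin n → ℝ} {γ : ℝ}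
    {u v u' v' : Fin n → ℝ} (h : SlopeOptimal lam γ u v) (h' : SlopeOptimal lam γ u' v') :
    ∑ i, (v i - v' i) ^ 2 ≤ ∑ i, (u i - u' i) ^ 2 := by
  have h1 := h.sum_residual_sub_mul_nonneg h'
  have h2 := h'.sum_residual_sub_mul_nonneg h
  have h3 : 0 ≤ ∑ i, ((u i - v i) - (u' i - v' i)) ^ 2 :=
    Finset.sum_nonneg fun i _ => sq_nonneg _
  have key : ∑ i, (u i - u' i) ^ 2 - ∑ i, (v i - v' i) ^ 2 =
      2 * ∑ i, ((u i - v i) - (u' i - v' i)) * v i +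
      2 * ∑ i, ((u' i - v' i) - (u i - v i)) * v' i +
      ∑ i, ((u i - v i) - (u' i - v' i)) ^ 2 := by
    simp only [Finset.mul_sum, ← Finset.sum_add_distrib, ← Finset.sum_sub_distrib]
    exact Finset.sum_congr rfl fun i _ => by ring
  linarith

theorem SlopeOptimal.sum_sq_le {n : ℕ} {lam : Fin n → ℝ} (hnonneg : ∀ i, 0 ≤ lam i) {γ : ℝ}
    (hγ : 0 ≤ γ) {u v : Fin n → ℝ} (h : SlopeOptimal lam γ u v) :
    ∑ i, v i ^ 2 ≤ ∑ i, u i ^ 2 := by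
  have h1 := (mul_nonneg hγ (slopeNorm_nonneg hnonneg v)).trans h.le_residual
  have h2 : 0 ≤ ∑ i, (u i - v i) ^ 2 := Finset.sum_nonneg fun i _ => sq_nonneg _
  have key : ∑ i, u i ^ 2 - ∑ i, v i ^ 2 =
      2 * ∑ i, (u i - v i) * v i + ∑ i, (u i - v i) ^ 2 := by
    simp only [Finset.mul_sum, ← Finset.sum_add_distrib, ← Finset.sum_sub_distrib]
    exact Finset.sum_congr rfl fun i _ => by ring
  linarith

theorem continuous_of_slopeOptimal {n : ℕ} {lam : Fin n → ℝ} {γ : ℝ}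
    {F : (Fin n → ℝ) → (Fin n → ℝ)} (hF : ∀ u, SlopeOptimal lam γ u (F u)) : Continuous F := by
  refine continuous_pi fun i => continuous_iff_continuousAt.mpr fun u => ?_
  have hlim : Tendsto (fun w : Fin n → ℝ => ∑ j, (w j - u j) ^ 2) (nhds u) (nhds 0) := by
    have : Continuous fun w : Fin n → ℝ => ∑ j, (w j - u j) ^ 2 := by fun_prop
    simpa using this.tendsto u
  have hsq : Tendsto (fun w => (F w i - F u i) ^ 2) (nhds u) (nhds 0) :=
    squeeze_zero (fun _ => sq_nonneg _) (fun w =>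
      (Finset.single_le_sum (f := fun j => (F w j - F u j) ^ 2) (fun j _ => sq_nonneg _)
        (Finset.mem_univ i)).trans ((hF w).sum_sq_sub_le (hF u))) hlim
  rw [ContinuousAt, tendsto_iff_norm_sub_tendsto_zero]
  simpa [Real.sqrt_sq_eq_abs] using hsq.sqrt

/-- Along the ray `s ↦ s • x`, the squared error is nondecreasing, quantitatively. -/
theorem SlopeOptimal.sum_sq_residual_sub_le {n : ℕ} {lam : Fin n → ℝ} {γ s t : ℝ}
    {x h a b : Fin n → ℝ} (hs : 0 ≤ s) (ht : 0 ≤ t)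
    (ha : SlopeOptimal lam γ (s • x + h) a) (hb : SlopeOptimal lam γ (t • x + h) b) :
    (t + s) * ∑ i, ((s * x i + h i - a i) - (t * x i + h i - b i)) ^ 2 ≤
      (t - s) * (∑ i, (b i - t * x i) ^ 2 - ∑ i, (a i - s * x i) ^ 2) := by
  have h1 := mul_nonneg ht (ha.sum_residual_sub_mul_nonneg hb)
  have h2 := mul_nonneg hs (hb.sum_residual_sub_mul_nonneg ha)
  simp only [Pi.add_apply, Pi.smul_apply, smul_eq_mul] at h1 h2
  have key : (t - s) * (∑ i, (b i - t * x i) ^ 2 - ∑ i, (a i - s * x i) ^ 2) =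
      2 * (t * ∑ i, ((s * x i + h i - a i) - (t * x i + h i - b i)) * a i) +
      2 * (s * ∑ i, ((t * x i + h i - b i) - (s * x i + h i - a i)) * b i) +
      (t + s) * ∑ i, ((s * x i + h i - a i) - (t * x i + h i - b i)) ^ 2 := by
    simp only [Finset.mul_sum, ← Finset.sum_add_distrib, ← Finset.sum_sub_distrib]
    exact Finset.sum_congr rfl fun i _ => by ring
  linarith

theorem SlopeOptimal.sum_sq_sub_smul_le {n : ℕ} {lam : Fin n → ℝ} {γ s t : ℝ}
    {x h a b : Fin n → ℝ} (hs : 0 ≤ s) (hst : s < t)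
    (ha : SlopeOptimal lam γ (s • x + h) a) (hb : SlopeOptimal lam γ (t • x + h) b) :
    ∑ i, (a i - s * x i) ^ 2 ≤ ∑ i, (b i - t * x i) ^ 2 := by
  have ht : 0 ≤ t := hs.trans hst.le
  have hkey := ha.sum_sq_residual_sub_le hs ht hb
  have hnn : 0 ≤ (t + s) * ∑ i, ((s * x i + h i - a i) - (t * x i + h i - b i)) ^ 2 :=
    mul_nonneg (add_nonneg ht hs) (Finset.sum_nonneg fun i _ => sq_nonneg _)
  exact sub_nonneg.mp (nonneg_of_mul_nonneg_right (hnn.trans hkey) (sub_pos.mpr hst))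

/-- At the noise value `h = -s • x`, the squared error strictly increases along the ray. -/
theorem SlopeOptimal.sum_sq_sub_smul_lt {n : ℕ} (hn : 1 ≤ n) {lam : Fin n → ℝ}
    (hlam : Antitone lam) (hnonneg : ∀ i, 0 ≤ lam i) (hpos : 0 < lam ⟨0, hn⟩) {γ s t : ℝ}
    (hγ : 0 < γ) {x a b : Fin n → ℝ} (hx : x ≠ 0) (hs : 0 ≤ s) (hst : s < t)
    (ha : SlopeOptimal lam γ (s • x + -(s • x)) a)
    (hb : SlopeOptimal lam γ (t • x + -(s • x)) b) :
    ∑ i, (a i - s * x i) ^ 2 < ∑ i, (b i - t * x i) ^ 2 := by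
  have ht : 0 < t := hs.trans_lt hst
  have ha0 (i) : a i = 0 := by
    have hle := ha.sum_sq_le hnonneg hγ.le
    have h0 : ∑ i, a i ^ 2 = 0 :=
      le_antisymm (hle.trans (by simp)) (Finset.sum_nonneg fun i _ => sq_nonneg _)
    have := (Finset.sum_eq_zero_iff_of_nonneg fun i _ => sq_nonneg (a i)).mp h0 i
      (Finset.mem_univ i)
    exact pow_eq_zero_iff two_ne_zero |>.mp this
  by_contra! hle
  have hkey := ha.sum_sq_residual_sub_le hs ht.le hb
  have hnn : 0 ≤ ∑ i, ((s * x i + (-(s • x)) i - a i) - (t * x i + (-(s • x)) i - b i)) ^ 2 :=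
    Finset.sum_nonneg fun i _ => sq_nonneg _
  have hsum : ∑ i, ((s * x i + (-(s • x)) i - a i) - (t * x i + (-(s • x)) i - b i)) ^ 2 = 0 := by
    nlinarith [mul_nonneg (sub_pos.mpr hst).le (sub_nonneg.mpr hle), mul_nonneg hs hnn,
      mul_nonneg ht.le hnn, mul_pos ht ht]
  have hres (i) : t * x i + -(s * x i) = b i := by
    have := (Finset.sum_eq_zero_iff_of_nonneg fun i _ => sq_nonneg _).mp hsum i
      (Finset.mem_univ i)
    have := pow_eq_zero_iff two_ne_zero |>.mp this
    simp only [Pi.neg_apply, Pi.smul_apply, smul_eq_mul, ha0] at this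
    linarith
  have hb0 : b ≠ 0 := by
    obtain ⟨i, hi⟩ := Function.ne_iff.mp hx
    refine fun hb0 => mul_ne_zero (sub_pos.mpr hst).ne' hi ?_
    have := hres i
    rw [hb0, Pi.zero_apply] at this
    linarith
  have := hb.le_residual
  simp only [Pi.add_apply, Pi.neg_apply, Pi.smul_apply, smul_eq_mul, hres, sub_self, zero_mul,
    Finset.sum_const_zero] at this
  exact absurd this (not_le.mpr (mul_pos hγ (slopeNorm_pos hn hlam hnonneg hpos hb0)))

instance isProbabilityMeasure_stdGaussian (n : ℕ) : IsProbabilityMeasure (_root_.stdGaussian n) :=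
  inferInstanceAs (IsProbabilityMeasure (Measure.pi fun _ => gaussianReal 0 1))

instance isOpenPosMeasure_stdGaussian (n : ℕ) :
    (_root_.stdGaussian n).IsOpenPosMeasure := by
  have : (gaussianReal 0 1).IsOpenPosMeasure :=
    (gaussianReal_absolutelyContinuous' 0 one_ne_zero).isOpenPosMeasure
  exact inferInstanceAs (Measure.pi fun _ : Fin n => gaussianReal 0 1).IsOpenPosMeasure

theorem integrable_sum_sq_stdGaussian (n : ℕ) :
    Integrable (fun h : Fin n → ℝ => ∑ i, h i ^ 2) (_root_.stdGaussian n) := by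
  refine integrable_finsetSum _ fun i _ => ?_
  exact integrable_comp_eval (μ := fun _ : Fin n => gaussianReal 0 1) (f := fun y : ℝ => y ^ 2)
    (memLp_id_gaussianReal 2).integrable_sq

theorem integrable_sum_sq_slopeOptimal_sub {n : ℕ} {lam : Fin n → ℝ}
    (hnonneg : ∀ i, 0 ≤ lam i) {γ : ℝ} (hγ : 0 ≤ γ) {y : Fin n → ℝ}
    {F : (Fin n → ℝ) → (Fin n → ℝ)} (hcont : Continuous F)
    (hF : ∀ h, SlopeOptimal lam γ (y + h) (F h)) :
    Integrable (fun h => ∑ i, (F h i - y i) ^ 2) (_root_.stdGaussian n) := by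
  refine (((integrable_sum_sq_stdGaussian n).const_mul 4).add
    (integrable_const (6 * ∑ i, y i ^ 2))).mono'
    (Continuous.aestronglyMeasurable (by fun_prop)) (ae_of_all _ fun h => ?_)
  rw [Real.norm_of_nonneg (Finset.sum_nonneg fun i _ => sq_nonneg _)]
  have h1 : ∑ i, (F h i - y i) ^ 2 ≤ 2 * ∑ i, F h i ^ 2 + 2 * ∑ i, y i ^ 2 := by
    simp only [Finset.mul_sum, ← Finset.sum_add_distrib]
    exact Finset.sum_le_sum fun i _ => by nlinarith [sq_nonneg (F h i + y i)]
  have h2 : ∑ i, (y + h) i ^ 2 ≤ 2 * ∑ i, h i ^ 2 + 2 * ∑ i, y i ^ 2 := by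
    simp only [Finset.mul_sum, ← Finset.sum_add_distrib, Pi.add_apply]
    exact Finset.sum_le_sum fun i _ => by nlinarith [sq_nonneg (h i - y i)]
  have h3 := (hF h).sum_sq_le hnonneg hγ
  simp only [Pi.add_apply]
  linarith

/-- for fixed `χ > 0`, the map `v ↦ f(v)/v`, with
`f(v) = E‖η(x + √v·h; √v·χ) − x‖₂²`, is nonincreasing on `(0,∞)`, and strictly
decreasing if `x ≠ 0`. -/
theorem slope_mse_over_v_decreasing
    (p : ℕ) (hp : 1 ≤ p)
    (lam : Fin p → ℝ)
    (hmono : ∀ i j : Fin p, i ≤ j → lam j ≤ lam i)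
    (hnonneg : ∀ i, 0 ≤ lam i)
    (hlam1 : 0 < lam ⟨0, hp⟩)
    (x : Fin p → ℝ)
    (χ : ℝ) (hχ : 0 < χ)
    (η : ℝ → (Fin p → ℝ) → (Fin p → ℝ))
    (hη : ∀ γ u, 0 ≤ γ → IsSlopeProx lam γ u (η γ u))
    (f : ℝ → ℝ)
    (hf : ∀ v : ℝ, f v = ∫ h,
      (∑ i, (η (Real.sqrt v * χ) (fun j => x j + Real.sqrt v * h j) i - x i) ^ 2)
        ∂ stdGaussian p) :
    AntitoneOn (fun v => f v / v) (Set.Ioi 0) ∧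
    (x ≠ 0 → StrictAntiOn (fun v => f v / v) (Set.Ioi 0)) := by
  have hlam : Antitone lam := fun i j hij => hmono i j hij
  set F : ℝ → (Fin p → ℝ) → (Fin p → ℝ) := fun v h =>
    (√v)⁻¹ • η (√v * χ) (fun j => x j + √v * h j) with hFdef
  have hF {v : ℝ} (hv : 0 < v) (h : Fin p → ℝ) :
      SlopeOptimal lam χ ((√v)⁻¹ • x + h) (F v h) := by
    have hσ : 0 < √v := Real.sqrt_pos.mpr hv
    have hγ : 0 ≤ √v * χ := by positivity
    have := ((hη (√v * χ) (fun j => x j + √v * h j) hγ).slopeOptimal hlam hnonneg hγ).smul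
      hlam hγ (inv_nonneg.mpr hσ.le)
    rw [inv_mul_cancel_left₀ hσ.ne'] at this
    convert this using 1
    ext j
    simp only [Pi.add_apply, Pi.smul_apply, smul_eq_mul, mul_add, inv_mul_cancel_left₀ hσ.ne']
  have hcont {v : ℝ} (hv : 0 < v) : Continuous (F v) := by
    have hη' : Continuous (η (√v * χ)) := continuous_of_slopeOptimal fun u =>
      (hη (√v * χ) u (by positivity)).slopeOptimal hlam hnonneg (by positivity)
    simp only [hFdef]
    fun_prop
  have hint {v : ℝ} (hv : 0 < v) :
      Integrable (fun h => ∑ i, (F v h i - (√v)⁻¹ * x i) ^ 2) (_root_.stdGaussian p) :=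
    integrable_sum_sq_slopeOptimal_sub hnonneg hχ.le (hcont hv) (hF hv)
  have hfv {v : ℝ} (hv : 0 < v) :
      f v / v = ∫ h, ∑ i, (F v h i - (√v)⁻¹ * x i) ^ 2 ∂_root_.stdGaussian p := by
    rw [hf, ← integral_div]
    refine integral_congr_ae (ae_of_all _ fun h => ?_)
    simp only [Finset.sum_div]
    refine Finset.sum_congr rfl fun i _ => ?_
    simp only [hFdef, Pi.smul_apply, smul_eq_mul]
    rw [← mul_sub, mul_pow, inv_pow, Real.sq_sqrt hv.le, div_eq_inv_mul]
  have hinv {v w : ℝ} (hv : 0 < v) (hvw : v < w) : (√w)⁻¹ < (√v)⁻¹ :=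
    inv_strictAnti₀ (Real.sqrt_pos.mpr hv) (Real.sqrt_lt_sqrt hv.le hvw)
  have hle {v w : ℝ} (hv : 0 < v) (hvw : v < w) (h : Fin p → ℝ) :
      ∑ i, (F w h i - (√w)⁻¹ * x i) ^ 2 ≤ ∑ i, (F v h i - (√v)⁻¹ * x i) ^ 2 :=
    (hF (hv.trans hvw) h).sum_sq_sub_smul_le (by positivity) (hinv hv hvw) (hF hv h)
  constructor
  · intro v hv w hw hvw
    rcases hvw.eq_or_lt with rfl | hvw
    · exact le_rfl
    simp only [hfv hv, hfv hw]
    exact integral_mono (hint hw) (hint hv) (hle hv hvw)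
  · intro hx v hv w hw hvw
    simp only [hfv hv, hfv hw]
    have hcv := hcont hv
    have hcw := hcont hw
    rw [← sub_pos, ← integral_sub (hint hv) (hint hw)]
    refine integral_pos_of_integrable_nonneg_nonzero (x := -((√w)⁻¹ • x)) (by fun_prop)
      ((hint hv).sub (hint hw)) (fun h => sub_nonneg.mpr (hle hv hvw h)) ?_
    exact (sub_pos.mpr (SlopeOptimal.sum_sq_sub_smul_lt hp hlam hnonneg hlam1 hχ hx
      (by positivity) (hinv hv hvw) (hF hw _) (hF hv _))).ne'
end

section
/- Let p ≥ 1 and let λ = (λ₁,…,λ_p) be nonincreasing nonnegative weights with λ₁ > 0, so that ‖·‖_λ is a norm on ℝ^p. Then its dual norm ‖v‖_{λ*} := sup{ ⟨a, v⟩ : a ∈ ℝ^p, ‖a‖_λ ≤ 1 } is given by ‖v‖_{λ*} = max_{1 ≤ j ≤ p} ( Σ_{i=1}^j |v|_{(i)} ) / ( Σ_{i=1}^j λ_i ). Consequently, for γ ≥ 0 the dual-norm ball { v : ‖v‖_{λ*} ≤ γ } equals { v ∈ ℝ^p : Σ_{i=1}^j |v|_{(i)} ≤ γ Σ_{i=1}^j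 λ_i for all 1 ≤ j ≤ p }. -/
open MeasureTheory ProbabilityTheory Filter

/-- The dual SLOPE norm ball of radius `γ`:
`D_γ = { v : Σ_{i≤j} |v|_(i) ≤ γ Σ_{i≤j} λ_i for all 1 ≤ j ≤ n }`. -/
noncomputable def slopeDualBall {n : ℕ} (lam : Fin n → ℝ) (γ : ℝ) : Set (Fin n → ℝ) :=
  {v | ∀ j : ℕ, 1 ≤ j → j ≤ n →
    (∑ i : Fin n, if (i : ℕ) < j then sortedAbs v i else 0)
      ≤ γ * ∑ i : Fin n, if (i : ℕ) < j then lam i else 0}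

/-- Abel summation: a nonnegative nonincreasing sequence paired with a sequence whose partial sums
are nonnegative gives a sum bounded below by the last weight times the total sum. -/
theorem last_mul_sum_le_sum_mul_of_antitone {n : ℕ} (c d : Fin (n + 1) → ℝ) (hc : Antitone c)
    (hd : ∀ j : Fin (n + 1), 0 ≤ ∑ i : Fin (n + 1), if (i : ℕ) ≤ (j : ℕ) then d i else 0) :
    c (Fin.last n) * ∑ i, d i ≤ ∑ i, c i * d i := by
  induction n with
  | zero => simp
  | succ n ih =>
    have hd' : ∀ j : Fin (n + 1),
        0 ≤ ∑ i : Fin (n + 1), if (i : ℕ) ≤ (j : ℕ) then d i.castSucc else 0 := by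
      intro j
      have h := hd j.castSucc
      rw [Fin.sum_univ_castSucc] at h
      have hj : ¬ (n + 1 ≤ (j : ℕ)) := by omega
      simpa [hj] using h
    have h := ih (fun i => c i.castSucc) (fun i => d i.castSucc)
      (fun i j hij => hc (Fin.castSucc_le_castSucc_iff.2 hij)) hd'
    have htot : 0 ≤ ∑ i : Fin (n + 1), d i.castSucc := by
      have h := hd' (Fin.last n)
      simpa [Fin.is_le] using h
    have hlast : c (Fin.last (n + 1)) ≤ c (Fin.last n).castSucc := hc (Fin.le_last _)
    rw [Fin.sum_univ_castSucc d, Fin.sum_univ_castSucc fun i => c i * d i, mul_add]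
    linarith [mul_le_mul_of_nonneg_right hlast htot]

theorem sum_mul_nonneg_of_antitone {n : ℕ} (c d : Fin n → ℝ) (hc : Antitone c)
    (hc0 : ∀ i, 0 ≤ c i)
    (hd : ∀ j : Fin n, 0 ≤ ∑ i : Fin n, if (i : ℕ) ≤ (j : ℕ) then d i else 0) :
    0 ≤ ∑ i, c i * d i := by
  cases n with
  | zero => simp
  | succ n =>
    refine le_trans (mul_nonneg (hc0 (Fin.last n)) ?_)
      (last_mul_sum_le_sum_mul_of_antitone c d hc hd)
    have h := hd (Fin.last n)
    simpa [Fin.is_le] using h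

theorem sortedAbs_nonneg {n : ℕ} (x : Fin n → ℝ) (i : Fin n) : 0 ≤ sortedAbs x i :=
  abs_nonneg _

theorem antitone_sortedAbs {n : ℕ} (x : Fin n → ℝ) : Antitone (sortedAbs x) := fun _ _ hij =>
  neg_le_neg_iff.1 (Tuple.monotone_sort (fun j => -|x j|) hij)

theorem sortedAbs_eq_of_antitone {n : ℕ} (x : Fin n → ℝ) (σ : Equiv.Perm (Fin n))
    (h : Antitone fun i => |x (σ i)|) : sortedAbs x = fun i => |x (σ i)| := by
  have key := Tuple.unique_monotone (f := fun j => -|x j|) (Tuple.monotone_sort _)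
    (show Monotone ((fun j => -|x j|) ∘ σ) from fun i j hij => neg_le_neg (h hij))
  funext i
  exact neg_injective (congrFun key i)

theorem sum_mul_le_sum_sortedAbs_mul {n : ℕ} (a v : Fin n → ℝ) :
    ∑ i, a i * v i ≤ ∑ i, sortedAbs a i * sortedAbs v i := by
  set σ := Tuple.sort fun j => -|a j| with hσ
  set τ := Tuple.sort fun j => -|v j| with hτ
  have hperm := ((antitone_sortedAbs a).monovary
    (antitone_sortedAbs v)).sum_mul_comp_perm_le_sum_mul (σ := σ.trans τ.symm)
  calc ∑ i, a i * v i ≤ ∑ i, |a i| * |v i| :=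
        Finset.sum_le_sum fun i _ => (le_abs_self _).trans (abs_mul _ _).le
    _ = ∑ i, |a (σ i)| * |v (σ i)| := (Equiv.sum_comp σ fun i => |a i| * |v i|).symm
    _ = ∑ i, sortedAbs a i * sortedAbs v ((σ.trans τ.symm) i) := by
        simp [sortedAbs, ← hσ, ← hτ]
    _ ≤ _ := hperm

/-- The pairing with `v` attains `(Σ_{i≤j} |v|_(i)) / L` at a vector whose sorted absolute values
are `1 / L` up to index `j` and zero afterwards. -/
theorem exists_sortedAbs_eq_indicator {n : ℕ} (v : Fin n → ℝ) (j : Fin n) {L : ℝ} (hL : 0 < L) :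
    ∃ a : Fin n → ℝ, (sortedAbs a = fun i : Fin n => if (i : ℕ) ≤ (j : ℕ) then L⁻¹ else 0) ∧
      ∑ i, a i * v i = (∑ i : Fin n, if (i : ℕ) ≤ (j : ℕ) then sortedAbs v i else 0) / L := by
  set τ := Tuple.sort fun j => -|v j| with hτ
  let sgn : ℝ → ℝ := fun t => if 0 ≤ t then 1 else -1
  have hsgn : ∀ t, |sgn t| = 1 := fun t => by
    by_cases h : 0 ≤ t <;> simp [sgn, h]
  have hsgn_mul : ∀ t, sgn t * t = |t| := fun t => by
    by_cases h : 0 ≤ t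
    · simp [sgn, h, abs_of_nonneg h]
    · simp [sgn, h, abs_of_neg (not_le.1 h)]
  let a : Fin n → ℝ := fun i => if (τ.symm i : ℕ) ≤ (j : ℕ) then sgn (v i) * L⁻¹ else 0
  have habs : (fun i => |a (τ i)|) = fun i : Fin n => if (i : ℕ) ≤ (j : ℕ) then L⁻¹ else 0 := by
    funext i
    by_cases h : (i : ℕ) ≤ (j : ℕ) <;> simp [a, -Fin.val_fin_le, h, abs_mul, hsgn, abs_of_pos hL]
  refine ⟨a, ?_, ?_⟩
  · rw [sortedAbs_eq_of_antitone a τ, habs]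
    rw [habs]
    intro i k hik
    have hik' : (i : ℕ) ≤ k := hik
    have hL' := inv_pos.2 hL
    dsimp only
    split_ifs <;> first | omega | linarith
  · rw [← Equiv.sum_comp τ, Finset.sum_div]
    refine Finset.sum_congr rfl fun i _ => ?_
    by_cases h : (i : ℕ) ≤ (j : ℕ)
    · have hv : sortedAbs v i = sgn (v (τ i)) * v (τ i) := (hsgn_mul _).symm
      simp only [a, Equiv.symm_apply_apply, h, if_true, hv]
      ring
    · simp [a, -Fin.val_fin_le, h]

/-- the dual norm of the SLOPE norm is
`‖v‖_{λ*} = max_{1≤j≤p} (Σ_{i≤j} |v|_(i)) / (Σ_{i≤j} λ_i)`, and for `γ ≥ 0`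
the dual-norm ball of radius `γ` equals `D_γ`. -/
theorem slope_dual_norm_formula
    (p : ℕ) (hp : 1 ≤ p)
    (lam : Fin p → ℝ)
    (hmono : ∀ i j : Fin p, i ≤ j → lam j ≤ lam i)
    (hnonneg : ∀ i, 0 ≤ lam i)
    (hlam1 : 0 < lam ⟨0, hp⟩) :
    (∀ v : Fin p → ℝ,
      sSup {t : ℝ | ∃ a : Fin p → ℝ, slopeNorm lam a ≤ 1 ∧ t = ∑ i, a i * v i}
        = ⨆ j : Fin p,
            (∑ i : Fin p, if (i : ℕ) ≤ (j : ℕ) then sortedAbs v i else 0)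
              / (∑ i : Fin p, if (i : ℕ) ≤ (j : ℕ) then lam i else 0))
    ∧ ∀ γ : ℝ, 0 ≤ γ →
        {v : Fin p → ℝ |
          sSup {t : ℝ | ∃ a : Fin p → ℝ, slopeNorm lam a ≤ 1 ∧ t = ∑ i, a i * v i} ≤ γ}
          = slopeDualBall lam γ := by
  have : Nonempty (Fin p) := ⟨⟨0, hp⟩⟩
  have hL : ∀ j : Fin p, 0 < ∑ i : Fin p, if (i : ℕ) ≤ (j : ℕ) then lam i else 0 := fun j =>
    Finset.sum_pos' (fun i _ => by split_ifs <;> simp [hnonneg])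
      ⟨⟨0, hp⟩, Finset.mem_univ _, by simpa using hlam1⟩
  have hbdd : ∀ v : Fin p → ℝ, BddAbove (Set.range fun j : Fin p =>
      (∑ i : Fin p, if (i : ℕ) ≤ (j : ℕ) then sortedAbs v i else 0)
        / (∑ i : Fin p, if (i : ℕ) ≤ (j : ℕ) then lam i else 0)) := fun v =>
    (Set.finite_range _).bddAbove
  have hdual : ∀ v : Fin p → ℝ,
      sSup {t : ℝ | ∃ a : Fin p → ℝ, slopeNorm lam a ≤ 1 ∧ t = ∑ i, a i * v i}
        = ⨆ j : Fin p,
            (∑ i : Fin p, if (i : ℕ) ≤ (j : ℕ) then sortedAbs v i else 0)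
              / (∑ i : Fin p, if (i : ℕ) ≤ (j : ℕ) then lam i else 0) := by
    intro v
    set M := ⨆ j : Fin p,
            (∑ i : Fin p, if (i : ℕ) ≤ (j : ℕ) then sortedAbs v i else 0)
              / (∑ i : Fin p, if (i : ℕ) ≤ (j : ℕ) then lam i else 0) with hM
    have hM0 : 0 ≤ M := Real.iSup_nonneg fun j =>
      div_nonneg (Finset.sum_nonneg fun i _ => by split_ifs <;> simp [sortedAbs_nonneg]) (hL j).le
    have hub : ∀ a : Fin p → ℝ, slopeNorm lam a ≤ 1 → ∑ i, a i * v i ≤ M := by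
      intro a ha
      have habel := sum_mul_nonneg_of_antitone (sortedAbs a)
        (fun i => M * lam i - sortedAbs v i) (antitone_sortedAbs a) (sortedAbs_nonneg a) (by
          intro j
          have hj := (div_le_iff₀ (hL j)).1 (le_ciSup (hbdd v) j)
          rw [← hM, Finset.mul_sum, ← sub_nonneg, ← Finset.sum_sub_distrib] at hj
          refine hj.trans_eq (Finset.sum_congr rfl fun i _ => ?_)
          split_ifs <;> simp)
      have hsplit : ∑ i, sortedAbs a i * (M * lam i - sortedAbs v i)
          = M * slopeNorm lam a - ∑ i, sortedAbs a i * sortedAbs v i := by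
        rw [slopeNorm, Finset.mul_sum, ← Finset.sum_sub_distrib]
        exact Finset.sum_congr rfl fun i _ => by ring
      have := sum_mul_le_sum_sortedAbs_mul a v
      have := mul_le_of_le_one_right hM0 ha
      linarith
    have hattain : ∀ j : Fin p,
        (∑ i : Fin p, if (i : ℕ) ≤ (j : ℕ) then sortedAbs v i else 0)
            / (∑ i : Fin p, if (i : ℕ) ≤ (j : ℕ) then lam i else 0)
          ∈ {t : ℝ | ∃ a : Fin p → ℝ, slopeNorm lam a ≤ 1 ∧ t = ∑ i, a i * v i} := by
      intro j
      obtain ⟨a, ha, hav⟩ := exists_sortedAbs_eq_indicator v j (hL j)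
      refine ⟨a, le_of_eq ?_, hav.symm⟩
      rw [slopeNorm, ha, ← mul_inv_cancel₀ (hL j).ne', Finset.sum_mul]
      exact Finset.sum_congr rfl fun i _ => by dsimp only; split_ifs <;> simp
    refine le_antisymm (csSup_le ⟨_, hattain ⟨0, hp⟩⟩ ?_) (ciSup_le fun j => ?_)
    · rintro t ⟨a, ha, rfl⟩
      exact hub a ha
    · refine le_csSup ⟨M, ?_⟩ (hattain j)
      rintro t ⟨a, ha, rfl⟩
      exact hub a ha
  refine ⟨hdual, fun γ _ => ?_⟩
  ext v
  rw [Set.mem_ofPred_eq, hdual v, ciSup_le_iff (hbdd v), slopeDualBall, Set.mem_ofPred_eq]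
  simp only [div_le_iff₀ (hL _)]
  constructor
  · intro h j hj hjp
    have hlt : ∀ i : Fin p, (i : ℕ) < j ↔ (i : ℕ) ≤ j - 1 := fun i => by omega
    simpa only [hlt] using h ⟨j - 1, by omega⟩
  · intro h j
    simpa only [Nat.lt_succ_iff] using h (j + 1) (by omega) j.isLt
end
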